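/- Let 𝓕 be a family of non-constant polynomials such that for each w₀ ∈ J(𝓕) there exists P₀ ∈ 𝓕 for which the polynomial P₀ − w₀ has at least three distinct simple roots. Then J(𝓕) is contained in the closure of the set of repelling fixed points of compositions P ∘ Q with P, Q ∈ 𝓕. -/

import Mathlib

open Filter Topology

/-- A sequence of complex functions tends to `∞` locally uniformly on `U`:
on every compact subset of `U` the moduli eventually exceed any bound,
uniformly. -/
def TendstoInftyLocallyUniformlyOn (F : ℕ → ℂ → ℂ) (U : Set ℂ) : Prop :=
  ∀ M : ℝ, ∀ K ⊆ U, IsCompact K → ∀ᶠ n in atTop, ∀ z ∈ K, M ≤ ‖F n z‖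

/-- The family `𝓕` is normal at the point `z₀` of the domain `D`: there is a
neighborhood `U ⊆ D` of `z₀` on which every sequence in `𝓕` has a subsequence
converging locally uniformly either to a holomorphic function or to `∞`. -/
def IsNormalAt (𝓕 : Set (ℂ → ℂ)) (D : Set ℂ) (z₀ : ℂ) : Prop :=
  ∃ U : Set ℂ, IsOpen U ∧ z₀ ∈ U ∧ U ⊆ D ∧
    ∀ f : ℕ → ℂ → ℂ, (∀ n, f n ∈ 𝓕) →
      ∃ φ : ℕ → ℕ, StrictMono φ ∧
        ((∃ g : ℂ → ℂ, DifferentiableOn ℂ g U ∧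
            TendstoLocallyUniformlyOn (fun n => f (φ n)) g atTop U) ∨
          TendstoInftyLocallyUniformlyOn (fun n => f (φ n)) U)

/-- The Fatou like set of the family `𝓕` on the domain `D`. -/
def fatouLike (𝓕 : Set (ℂ → ℂ)) (D : Set ℂ) : Set ℂ :=
  {z ∈ D | IsNormalAt 𝓕 D z}

/-- The Julia like set of the family `𝓕` on the domain `D`. -/
def juliaLike (𝓕 : Set (ℂ → ℂ)) (D : Set ℂ) : Set ℂ :=
  D \ fatouLike 𝓕 D

/-- Montel: a locally bounded sequence of holomorphic functions has a locally uniformly convergent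
subsequence. -/
theorem exists_subseq_tendstoLocallyUniformlyOn_of_bounded {U : Set ℂ} (hU : IsOpen U)
    (f : ℕ → ℂ → ℂ) (hf : ∀ n, DifferentiableOn ℂ (f n) U)
    (hb : ∀ K ⊆ U, IsCompact K → ∃ C : ℝ, ∀ n, ∀ z ∈ K, ‖f n z‖ ≤ C) :
    ∃ φ : ℕ → ℕ, StrictMono φ ∧ ∃ g : ℂ → ℂ, DifferentiableOn ℂ g U ∧
      TendstoLocallyUniformlyOn (fun n => f (φ n)) g atTop U := by
  classical
  have : LocallyCompactSpace U := hU.locallyCompactSpace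
  let F : ℕ → C(U, ℂ) := fun n => ⟨fun z => f n z, (hf n).continuousOn.domRestrict⟩
  have heq : Equicontinuous (fun n => (F n : U → ℂ)) := by
    rintro ⟨z, hz⟩
    obtain ⟨r, hr, hrU⟩ := Metric.nhds_basis_closedBall.mem_iff.1 (hU.mem_nhds hz)
    obtain ⟨C, hC⟩ := hb _ hrU (isCompact_closedBall z r)
    have hC0 : 0 ≤ C := (norm_nonneg _).trans (hC 0 z (Metric.mem_closedBall_self hr.le))
    refine Metric.equicontinuousAt_of_continuity_modulus (fun w : U => (2 * C) / r * dist (w : ℂ) z)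
      ?_ _ ?_
    · have : Continuous (fun w : U => (2 * C) / r * dist (w : ℂ) z) := by fun_prop
      simpa using this.tendsto ⟨z, hz⟩
    · have : ∀ᶠ w : U in 𝓝 ⟨z, hz⟩, (w : ℂ) ∈ Metric.ball z r :=
        continuous_subtype_val.continuousAt.eventually_mem (Metric.ball_mem_nhds z hr)
      filter_upwards [this] with w hw n
      rw [dist_comm]
      refine Complex.dist_le_div_mul_dist_of_mapsTo_ball
        ((hf n).mono (Metric.ball_subset_closedBall.trans hrU)) (fun v hv => ?_) hw
      rw [Metric.mem_closedBall, dist_eq_norm]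
      refine (norm_sub_le _ _).trans ?_
      linarith [hC n v (Metric.ball_subset_closedBall hv),
        hC n z (Metric.mem_closedBall_self hr.le)]
  have : T2Space (UniformOnFun U ℂ {K : Set U | IsCompact K}) :=
    UniformOnFun.t2Space_of_covering
      (Set.eq_univ_of_forall fun x => ⟨{x}, isCompact_singleton, rfl⟩)
  have hcpt : IsCompact (closure (Set.range F)) := by
    refine ArzelaAscoli.isCompact_closure_of_isClosedEmbedding (X := U) (α := ℂ)
      (F := fun g : C(U, ℂ) => (g : U → ℂ)) (𝔖 := {K | IsCompact K}) (fun K hK => hK)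
      ContinuousMap.isUniformEmbedding_toUniformOnFunIsCompact.isClosedEmbedding ?_ ?_
    · intro K _
      refine Equicontinuous.equicontinuousOn ?_ K
      intro z V hV
      filter_upwards [heq z V hV] with w hw
      rintro ⟨_, n, rfl⟩
      exact hw n
    · intro K _ x _
      obtain ⟨C, hC⟩ := hb {(x : ℂ)} (by simp) isCompact_singleton
      refine ⟨Metric.closedBall 0 C, isCompact_closedBall _ _, ?_⟩
      rintro _ ⟨n, rfl⟩
      exact mem_closedBall_zero_iff.2 (hC n x rfl)
  obtain ⟨G, -, φ, hφ, hG⟩ := hcpt.tendsto_subseq (fun n => subset_closure (Set.mem_range_self n))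
  have hlim : TendstoLocallyUniformlyOn (fun n => f (φ n))
      (fun z => if h : z ∈ U then G ⟨z, h⟩ else 0) atTop U := by
    rw [tendstoLocallyUniformlyOn_iff_tendstoLocallyUniformly_comp_coe]
    have := ContinuousMap.tendsto_iff_tendstoLocallyUniformly.1 hG
    have hGeq : (fun z => if h : z ∈ U then G ⟨z, h⟩ else 0) ∘ ((↑) : U → ℂ) = G := by
      ext z
      simp
    rw [hGeq]
    exact this
  exact ⟨φ, hφ, _, hlim.differentiableOn (Eventually.of_forall fun n => hf (φ n)) hU, hlim⟩

/-- Schwarz's lemma for holomorphic maps from a disc to the right half-plane. -/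
theorem schwarz_halfPlane {F : ℂ → ℂ} {z : ℂ} {d : ℝ} (hF : DifferentiableOn ℂ F (Metric.ball z d))
    (hre : ∀ w ∈ Metric.ball z d, 0 < (F w).re) {w : ℂ} (hw : w ∈ Metric.ball z d) :
    ‖F w - F z‖ ≤ ‖F w + (starRingEnd ℂ) (F z)‖ * (dist w z / d) := by
  have hd : 0 < d := Metric.pos_of_mem_ball hw
  have hz : z ∈ Metric.ball z d := Metric.mem_ball_self hd
  have hne : ∀ v ∈ Metric.ball z d, F v + (starRingEnd ℂ) (F z) ≠ 0 := fun v hv h => by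
    have := congrArg Complex.re h
    simp at this
    linarith [hre v hv, hre z hz]
  have key := Complex.dist_le_div_mul_dist_of_mapsTo_ball (R₂ := 1)
    (f := fun v => (F v - F z) / (F v + (starRingEnd ℂ) (F z)))
    ((hF.sub_const _).div (hF.add_const _) hne) (fun v hv => ?_) hw
  · simp only [sub_self, zero_div, dist_zero_right, norm_div] at key
    rw [div_le_iff₀ (norm_pos_iff.2 (hne w hw))] at key
    calc _ ≤ _ := key
      _ = _ := by ring
  · simp only [sub_self, zero_div, mem_closedBall_zero_iff, norm_div]
    refine div_le_one_of_le₀ ?_ (norm_nonneg _)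
    rw [← sq_le_sq₀ (norm_nonneg _) (norm_nonneg _), Complex.sq_norm, Complex.sq_norm,
      Complex.normSq_apply, Complex.normSq_apply]
    simp
    nlinarith [mul_pos (hre v hv) (hre z hz)]

theorem norm_deriv_le_of_re_pos {F : ℂ → ℂ} {z : ℂ} {d : ℝ} (hd : 0 < d)
    (hF : DifferentiableOn ℂ F (Metric.ball z d))
    (hre : ∀ w ∈ Metric.ball z d, 0 < (F w).re) :
    ‖deriv F z‖ ≤ 2 * (F z).re / d := by
  have hnhds : Metric.ball z d ∈ 𝓝 z := Metric.ball_mem_nhds z hd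
  have hda : DifferentiableAt ℂ F z := hF.differentiableAt hnhds
  have hs := (hasDerivAt_iff_tendsto_slope.1 hda.hasDerivAt).norm
  have hc : Tendsto (fun w => ‖F w + (starRingEnd ℂ) (F z)‖ / d) (𝓝[≠] z)
      (𝓝 (‖F z + (starRingEnd ℂ) (F z)‖ / d)) :=
    ((hda.continuousAt.add_const _).norm.div_const _).tendsto.mono_left nhdsWithin_le_nhds
  have : ‖F z + (starRingEnd ℂ) (F z)‖ / d = 2 * (F z).re / d := by
    rw [Complex.add_conj, Complex.norm_real, Real.norm_of_nonneg]
    linarith [hre z (Metric.mem_ball_self hd)]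
  rw [← this]
  refine le_of_tendsto_of_tendsto hs hc ?_
  filter_upwards [self_mem_nhdsWithin, mem_nhdsWithin_of_mem_nhds hnhds] with w hw hwb
  have hwz : 0 < ‖w - z‖ := norm_pos_iff.2 (sub_ne_zero.2 hw)
  rw [slope_def_field, norm_div, div_le_iff₀ hwz]
  refine (schwarz_halfPlane hF hre hwb).trans_eq ?_
  rw [dist_eq_norm]; ring

theorem re_lower_bound_of_re_pos {F : ℂ → ℂ} {z : ℂ} {d : ℝ}
    (hF : DifferentiableOn ℂ F (Metric.ball z d))
    (hre : ∀ w ∈ Metric.ball z d, 0 < (F w).re) {w : ℂ} (hw : w ∈ Metric.ball z d) :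
    (F z).re * (1 - dist w z / d) / 2 ≤ (F w).re := by
  have hd : 0 < d := Metric.pos_of_mem_ball hw
  have hz := hre z (Metric.mem_ball_self hd)
  have h := schwarz_halfPlane hF hre hw
  set t := dist w z / d with ht
  have ht0 : 0 ≤ t := by positivity
  have ht1 : t < 1 := (div_lt_one hd).2 hw
  have h2 := pow_le_pow_left₀ (norm_nonneg _) h 2
  rw [mul_pow, Complex.sq_norm, Complex.sq_norm, Complex.normSq_apply, Complex.normSq_apply] at h2
  simp at h2
  have hw' := hre w hw
  set a := (F z).re
  set x := (F w).re
  set y := (F w).im - (F z).im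
  have h3 : (x - a) ^ 2 ≤ ((x + a) * t) ^ 2 := by
    have : (F w).im + -(F z).im = y := by simp [y]; ring
    rw [this] at h2
    nlinarith [mul_nonneg (mul_self_nonneg y) (by nlinarith : (0:ℝ) ≤ 1 - t ^ 2)]
  have h4 := abs_le_of_sq_le_sq h3 (by positivity)
  have h5 : a - x ≤ (x + a) * t := by linarith [(abs_le.1 h4).1]
  nlinarith

theorem exists_log_on_ball {f : ℂ → ℂ} {z : ℂ} {d : ℝ} (hd : 0 < d)
    (hf : DifferentiableOn ℂ f (Metric.ball z d)) (h0 : ∀ w ∈ Metric.ball z d, f w ≠ 0) :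
    ∃ F : ℂ → ℂ, (∀ w ∈ Metric.ball z d, HasDerivAt F (deriv f w / f w) w) ∧
      ∀ w ∈ Metric.ball z d, f w = Complex.exp (F w) := by
  have hz := Metric.mem_ball_self (x := z) hd
  have hdiv : DifferentiableOn ℂ (fun w => deriv f w / f w) (Metric.ball z d) :=
    (hf.deriv Metric.isOpen_ball).div hf h0
  obtain ⟨F, hFz, hF⟩ := hdiv.isExactOn_ball.with_val_at z (Complex.log (f z))
  refine ⟨F, hF, fun w hw => ?_⟩
  have hd' : ∀ v ∈ Metric.ball z d, HasDerivAt (fun v => f v * Complex.exp (-F v)) 0 v := by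
    intro v hv
    have h1 := (hf.differentiableAt (Metric.isOpen_ball.mem_nhds hv)).hasDerivAt
    refine (h1.mul (hF v hv).neg.cexp).congr_deriv ?_
    rw [mul_comm (Complex.exp _), ← mul_assoc, ← add_mul, mul_neg, mul_div_cancel₀ _ (h0 v hv),
      add_neg_cancel, zero_mul]
  have hconst := Metric.isOpen_ball.is_const_of_deriv_eq_zero
    (convex_ball z d).isPreconnected
    (fun v hv => (hd' v hv).differentiableAt.differentiableWithinAt)
    (fun v hv => (hd' v hv).deriv) hw hz
  simp only [hFz] at hconst
  rw [Complex.exp_neg, Complex.exp_neg, Complex.exp_log (h0 z hz),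
    mul_inv_cancel₀ (h0 z hz)] at hconst
  exact (mul_inv_eq_one₀ (Complex.exp_ne_zero _)).1 hconst

theorem norm_deriv_div_le_of_one_lt_norm {f : ℂ → ℂ} {z : ℂ} {d : ℝ} (hd : 0 < d)
    (hf : DifferentiableOn ℂ f (Metric.ball z d)) (h1 : ∀ w ∈ Metric.ball z d, 1 < ‖f w‖) :
    ‖deriv f z‖ ≤ ‖f z‖ * (2 * Real.log ‖f z‖ / d) ∧
      ∀ w ∈ Metric.ball z d, Real.log ‖f z‖ * (1 - dist w z / d) / 2 ≤ Real.log ‖f w‖ := by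
  have h0 : ∀ w ∈ Metric.ball z d, f w ≠ 0 := fun w hw =>
    norm_pos_iff.1 (one_pos.trans (h1 w hw))
  have hz := Metric.mem_ball_self (x := z) hd
  obtain ⟨F, hF, hexp⟩ := exists_log_on_ball hd hf h0
  have hre : ∀ w ∈ Metric.ball z d, Real.log ‖f w‖ = (F w).re := fun w hw => by
    rw [hexp w hw, Complex.norm_exp, Real.log_exp]
  have hFd : DifferentiableOn ℂ F (Metric.ball z d) := fun w hw =>
    (hF w hw).differentiableAt.differentiableWithinAt
  have hpos : ∀ w ∈ Metric.ball z d, 0 < (F w).re := fun w hw => by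
    rw [← hre w hw]; exact Real.log_pos (h1 w hw)
  constructor
  · have := norm_deriv_le_of_re_pos hd hFd hpos
    rwa [(hF z hz).deriv, norm_div, div_le_iff₀' (norm_pos_iff.2 (h0 z hz)), ← hre z hz] at this
  · intro w hw
    rw [hre z hz, hre w hw]
    exact re_lower_bound_of_re_pos hFd hpos hw

theorem log_norm_le_of_norm_le_one_on_frontier {f : ℂ → ℂ} (hf : Differentiable ℂ f) {z z₁ : ℂ}
    {M : ℝ} (hne : z₁ ≠ z) (h1 : ∀ w ∈ Metric.ball z (dist z₁ z), 1 < ‖f w‖) (hz₁ : ‖f z₁‖ ≤ 1)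
    (hM : ‖deriv f z₁‖ ≤ M) : Real.log ‖f z‖ ≤ 2 * M * dist z₁ z := by
  set d := dist z₁ z with hd
  have hd0 : 0 < d := dist_pos.2 hne
  set u := Real.log ‖f z‖ with hu
  have hu0 : 0 < u := Real.log_pos (h1 z (Metric.mem_ball_self hd0))
  have hlow := (norm_deriv_div_le_of_one_lt_norm hd0 hf.differentiableOn h1).2
  have hline : HasDerivAt (fun t : ℝ => f (z₁ + t * (z - z₁))) (deriv f z₁ * (z - z₁)) 0 := by
    have hl : HasDerivAt (fun t : ℝ => z₁ + (t : ℂ) * (z - z₁)) (z - z₁) 0 := by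
      simpa using ((Complex.ofRealCLM.hasDerivAt (x := (0 : ℝ))).mul_const (z - z₁)).const_add z₁
    have hfz : HasDerivAt f (deriv f z₁) (z₁ + ((0 : ℝ) : ℂ) * (z - z₁)) := by
      simpa using (hf z₁).hasDerivAt
    exact hfz.comp (0 : ℝ) hl
  have hs := (hline.tendsto_slope_zero_right).norm
  have hbound : u / 2 ≤ ‖deriv f z₁ * (z - z₁)‖ := by
    refine ge_of_tendsto hs ?_
    filter_upwards [Ioo_mem_nhdsGT (zero_lt_one' ℝ)] with s hs
    obtain ⟨hs0, hs1⟩ := hs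
    have hdist : dist (z₁ + (s : ℂ) * (z - z₁)) z = (1 - s) * d := by
      rw [hd, dist_eq_norm, dist_eq_norm,
        show z₁ + (s : ℂ) * (z - z₁) - z = ((1 - s : ℝ) : ℂ) * (z₁ - z) by push_cast; ring,
        norm_mul, Complex.norm_real, Real.norm_of_nonneg (by linarith)]
    have hmem : z₁ + (s : ℂ) * (z - z₁) ∈ Metric.ball z d := by
      rw [Metric.mem_ball, hdist]; nlinarith
    have h2 := hlow _ hmem
    rw [hdist, mul_div_cancel_right₀ _ hd0.ne'] at h2
    have h3 := Real.add_one_le_exp (Real.log ‖f (z₁ + (s : ℂ) * (z - z₁))‖)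
    rw [Real.exp_log (one_pos.trans (h1 _ hmem))] at h3
    simp only [zero_add, Complex.ofReal_zero, zero_mul, add_zero, norm_smul, norm_inv,
      Real.norm_of_nonneg hs0.le]
    rw [le_inv_mul_iff₀ hs0]
    have h4 := norm_sub_norm_le (f (z₁ + (s : ℂ) * (z - z₁))) (f z₁)
    nlinarith
  rw [norm_mul, ← dist_eq_norm, dist_comm, ← hd] at hbound
  nlinarith

/-- A bound for `f'` on `{|f| ≤ 1}` propagates to a growth estimate for `f'` on a smaller ball. -/
theorem norm_deriv_le_of_norm_deriv_le_on_unit_sublevel {f : ℂ → ℂ} (hf : Differentiable ℂ f)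
    {z₀ : ℂ} {r M : ℝ} (hM0 : 0 ≤ M)
    (hM : ∀ z ∈ Metric.ball z₀ r, ‖f z‖ ≤ 1 → ‖deriv f z‖ ≤ M) {z : ℂ}
    (hz : z ∈ Metric.ball z₀ (r / 2)) :
    ‖deriv f z‖ ≤ max 1 ‖f z‖ * (4 * M + 4 * Real.posLog ‖f z‖ / r) := by
  have hr : 0 < r := by linarith [Metric.pos_of_mem_ball hz]
  rcases le_or_gt ‖f z‖ 1 with h1 | h1
  · have h2 := hM z (Metric.ball_subset_ball (by linarith) hz) h1
    have h3 : 0 ≤ Real.posLog ‖f z‖ := Real.posLog_nonneg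
    have h4 : 0 ≤ 4 * Real.posLog ‖f z‖ / r := by positivity
    rw [max_eq_left h1]
    linarith
  · rw [max_eq_right h1.le, Real.posLog_eq_log (by rw [abs_of_pos (by linarith)]; exact h1.le)]
    have hu0 : 0 < Real.log ‖f z‖ := Real.log_pos h1
    have hu1 : 0 ≤ 4 * Real.log ‖f z‖ / r := by positivity
    by_cases hS : ∃ w ∈ Metric.ball z (r / 2), ‖f w‖ ≤ 1
    · obtain ⟨w, hw, hfw⟩ := hS
      have hcl : IsClosed {v : ℂ | ‖f v‖ ≤ 1} := isClosed_le hf.continuous.norm continuous_const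
      obtain ⟨z₁, hz₁, hdist⟩ := hcl.exists_infDist_eq_dist ⟨w, hfw⟩ z
      have hz₁w : dist z₁ z ≤ dist w z := by
        rw [dist_comm, ← hdist, dist_comm]; exact Metric.infDist_le_dist_of_mem hfw
      have hne : z₁ ≠ z := by rintro rfl; exact absurd hz₁ (not_le.2 h1)
      have hd0 : 0 < dist z₁ z := dist_pos.2 hne
      have hgt : ∀ v ∈ Metric.ball z (dist z₁ z), 1 < ‖f v‖ := by
        intro v hv
        by_contra! hcon
        have := Metric.infDist_le_dist_of_mem (x := z) (s := {v : ℂ | ‖f v‖ ≤ 1}) hcon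
        rw [hdist, dist_comm, dist_comm z v] at this
        exact absurd (Metric.mem_ball.1 hv) (not_lt.2 this)
      have hz₁r : z₁ ∈ Metric.ball z₀ r := by
        rw [Metric.mem_ball] at hw hz ⊢
        linarith [dist_triangle z₁ z z₀]
      have h2 := log_norm_le_of_norm_le_one_on_frontier hf hne hgt hz₁ (hM z₁ hz₁r hz₁)
      have h3 := (norm_deriv_div_le_of_one_lt_norm hd0 hf.differentiableOn hgt).1
      refine h3.trans (mul_le_mul_of_nonneg_left ?_ (norm_nonneg _))
      have : 2 * Real.log ‖f z‖ / dist z₁ z ≤ 4 * M := by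
        rw [div_le_iff₀ hd0]; linarith
      linarith
    · push Not at hS
      have h3 := (norm_deriv_div_le_of_one_lt_norm (half_pos hr) hf.differentiableOn hS).1
      refine h3.trans (mul_le_mul_of_nonneg_left ?_ (norm_nonneg _))
      have : 2 * Real.log ‖f z‖ / (r / 2) = 4 * Real.log ‖f z‖ / r := by field_simp; ring
      linarith

theorem abs_log_sub_log_le_of_norm_deriv_le_on_unit_sublevel {f : ℂ → ℂ} (hf : Differentiable ℂ f)
    {z₀ : ℂ} {r M : ℝ} (hM0 : 0 < M)
    (hM : ∀ z ∈ Metric.ball z₀ r, ‖f z‖ ≤ 1 → ‖deriv f z‖ ≤ M) {z : ℂ}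
    (hz : z ∈ Metric.ball z₀ (r / 2)) :
    |Real.log (M * r + Real.log (1 + ‖f z‖ ^ 2)) - Real.log (M * r + Real.log (1 + ‖f z₀‖ ^ 2))| ≤
      8 / r * dist z z₀ := by
  have hr : 0 < r := by linarith [Metric.pos_of_mem_ball hz]
  set γ : ℝ → ℂ := fun t => z₀ + t * (z - z₀) with hγ
  have hγd : ∀ t, HasDerivAt γ (z - z₀) t := fun t => by
    change HasDerivAt (fun t : ℝ => z₀ + (t : ℂ) * (z - z₀)) (z - z₀) t
    simpa using ((Complex.ofRealCLM.hasDerivAt (x := t)).mul_const (z - z₀)).const_add z₀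
  have hγmem : ∀ t ∈ Set.Icc (0 : ℝ) 1, γ t ∈ Metric.ball z₀ (r / 2) := fun t ht => by
    rw [Metric.mem_ball, dist_eq_norm] at hz ⊢
    simp only [hγ, add_sub_cancel_left, norm_mul, Complex.norm_real, Real.norm_of_nonneg ht.1]
    nlinarith [norm_nonneg (z - z₀), ht.2]
  have hpos1 : ∀ w, 0 < 1 + ‖f w‖ ^ 2 := fun w => by positivity
  have hL : ∀ w, 0 ≤ Real.log (1 + ‖f w‖ ^ 2) := fun w =>
    Real.log_nonneg (by nlinarith [sq_nonneg ‖f w‖])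
  have hpos2 : ∀ w, 0 < M * r + Real.log (1 + ‖f w‖ ^ 2) := fun w => by
    have := hL w; positivity
  have hder : ∀ t, HasDerivAt
      (fun t : ℝ => Real.log (M * r + Real.log (1 + ‖f (γ t)‖ ^ 2)))
      (2 * inner ℝ (f (γ t)) (deriv f (γ t) * (z - z₀)) / (1 + ‖f (γ t)‖ ^ 2) /
        (M * r + Real.log (1 + ‖f (γ t)‖ ^ 2))) t := fun t => by
    have h1 : HasDerivAt (fun t => f (γ t)) (deriv f (γ t) * (z - z₀)) t :=
      (hf (γ t)).hasDerivAt.comp t (hγd t)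
    exact (((h1.norm_sq.const_add 1).log (hpos1 _).ne').const_add (M * r)).log (hpos2 _).ne'
  have hbd : ∀ t ∈ Set.Icc (0 : ℝ) 1,
      ‖2 * inner ℝ (f (γ t)) (deriv f (γ t) * (z - z₀)) / (1 + ‖f (γ t)‖ ^ 2) /
        (M * r + Real.log (1 + ‖f (γ t)‖ ^ 2))‖ ≤ 8 / r * dist z z₀ := fun t ht => by
    have h1 := norm_deriv_le_of_norm_deriv_le_on_unit_sublevel hf hM0.le hM (hγmem t ht)
    have h2 := norm_inner_le_norm (𝕜 := ℝ) (f (γ t)) (deriv f (γ t) * (z - z₀))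
    set w := γ t
    set A := ‖f w‖ with hA
    have hA0 : 0 ≤ A := norm_nonneg _
    have hlog : Real.posLog A ≤ Real.log (1 + A ^ 2) := by
      rw [Real.posLog_def]
      refine max_le (hL w) ?_
      rcases hA0.eq_or_lt with h | h
      · rw [← h]; simp
      · exact Real.log_le_log h (by nlinarith [sq_nonneg (A - 1)])
    have hmax : A * max 1 A ≤ 1 + A ^ 2 := by
      rcases max_cases 1 A with h | h <;> rw [h.1] <;> nlinarith [sq_nonneg (A - 1)]
    rw [norm_div, norm_div, norm_mul, Real.norm_of_nonneg (hpos1 w).le,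
      Real.norm_of_nonneg (hpos2 w).le, Real.norm_of_nonneg (zero_le_two (α := ℝ)),
      div_le_iff₀ (hpos2 w), div_le_iff₀ (hpos1 w)]
    rw [norm_mul, ← dist_eq_norm] at h2
    set D := dist z z₀
    have hD : 0 ≤ D := dist_nonneg
    set L := Real.log (1 + A ^ 2)
    have h5 : 4 * M + 4 * Real.posLog A / r ≤ 4 / r * (M * r + L) := by
      have : 4 / r * (M * r + L) = 4 * M + 4 * L / r := by field_simp
      rw [this]; gcongr
    have h6 : 0 ≤ 4 / r * (M * r + L) := by have := (hpos2 w).le; positivity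
    calc 2 * ‖(inner ℝ (f w) (deriv f w * (z - z₀)) : ℝ)‖ ≤ 2 * (A * (‖deriv f w‖ * D)) := by gcongr
      _ ≤ 2 * (A * ((max 1 A * (4 / r * (M * r + L))) * D)) := by
          gcongr
          exact h1.trans (by gcongr)
      _ = 2 * (A * max 1 A) * ((4 / r * (M * r + L)) * D) := by ring
      _ ≤ 2 * (1 + A ^ 2) * ((4 / r * (M * r + L)) * D) := by gcongr
      _ = _ := by ring
  have := (convex_Icc (0 : ℝ) 1).norm_image_sub_le_of_norm_hasDerivWithin_le
    (fun t ht => (hder t).hasDerivWithinAt) hbd (Set.left_mem_Icc.2 zero_le_one)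
    (Set.right_mem_Icc.2 zero_le_one)
  simpa [hγ] using this

theorem log_one_add_sq_norm_comparison {f : ℂ → ℂ} (hf : Differentiable ℂ f)
    {z₀ : ℂ} {r M : ℝ} (hM0 : 0 < M)
    (hM : ∀ z ∈ Metric.ball z₀ r, ‖f z‖ ≤ 1 → ‖deriv f z‖ ≤ M) {z : ℂ}
    (hz : z ∈ Metric.ball z₀ (r / 2)) :
    M * r + Real.log (1 + ‖f z‖ ^ 2) ≤
        Real.exp (8 / r * dist z z₀) * (M * r + Real.log (1 + ‖f z₀‖ ^ 2)) ∧
      M * r + Real.log (1 + ‖f z₀‖ ^ 2) ≤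
        Real.exp (8 / r * dist z z₀) * (M * r + Real.log (1 + ‖f z‖ ^ 2)) := by
  have hr : 0 < r := by linarith [Metric.pos_of_mem_ball hz]
  have hpos2 : ∀ w, 0 < M * r + Real.log (1 + ‖f w‖ ^ 2) := fun w => by
    have : 0 ≤ Real.log (1 + ‖f w‖ ^ 2) := Real.log_nonneg (by nlinarith [sq_nonneg ‖f w‖])
    positivity
  have h := abs_le.1 (abs_log_sub_log_le_of_norm_deriv_le_on_unit_sublevel hf hM0 hM hz)
  constructor
  · rw [← Real.exp_log (hpos2 z), ← Real.exp_log (hpos2 z₀), ← Real.exp_add, Real.exp_le_exp]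
    linarith [h.2]
  · rw [← Real.exp_log (hpos2 z), ← Real.exp_log (hpos2 z₀), ← Real.exp_add, Real.exp_le_exp]
    linarith [h.1]

/-- Marty-type criterion: a family of entire functions is normal at `z₀` if the derivatives are
uniformly bounded on the sets `{|f| ≤ 1}` near `z₀`. -/
theorem isNormalAt_of_norm_deriv_le_on_unit_sublevel {𝓕 : Set (ℂ → ℂ)}
    (h𝓕 : ∀ f ∈ 𝓕, Differentiable ℂ f) {z₀ : ℂ} {r M : ℝ} (hr : 0 < r) (hM0 : 0 < M)
    (hM : ∀ f ∈ 𝓕, ∀ z ∈ Metric.ball z₀ r, ‖f z‖ ≤ 1 → ‖deriv f z‖ ≤ M) :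
    IsNormalAt 𝓕 Set.univ z₀ := by
  refine ⟨Metric.ball z₀ (r / 2), Metric.isOpen_ball, Metric.mem_ball_self (half_pos hr),
    Set.subset_univ _, fun f hf => ?_⟩
  have hlog0 : ∀ x : ℝ, 0 ≤ Real.log (1 + x ^ 2) := fun x =>
    Real.log_nonneg (by nlinarith [sq_nonneg x])
  have hexp : ∀ z ∈ Metric.ball z₀ (r / 2), Real.exp (8 / r * dist z z₀) ≤ Real.exp 4 :=
    fun z hz => by
      rw [Real.exp_le_exp, div_mul_eq_mul_div, div_le_iff₀ hr]
      linarith [Metric.mem_ball.1 hz]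
  have hcomp := fun n z (hz : z ∈ Metric.ball z₀ (r / 2)) =>
    log_one_add_sq_norm_comparison (h𝓕 _ (hf n)) hM0 (hM _ (hf n)) hz
  by_cases htend : Tendsto (fun n => ‖f n z₀‖) atTop atTop
  · refine ⟨id, strictMono_id, Or.inr fun B K hK _ => ?_⟩
    set C := Real.exp 4 * (M * r + Real.log (1 + B ^ 2)) with hC
    filter_upwards [htend.eventually_ge_atTop (Real.exp C)] with n hn z hz
    by_contra! hlt
    have h1 := (hcomp n z (hK hz)).2
    have h2 : Real.log (1 + ‖f n z‖ ^ 2) ≤ Real.log (1 + B ^ 2) := by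
      apply Real.log_le_log (by positivity)
      have := norm_nonneg (f n z)
      simp only [id] at hlt
      nlinarith
    have h3 : M * r + Real.log (1 + ‖f n z₀‖ ^ 2) ≤ C := by
      refine h1.trans (mul_le_mul (hexp z (hK hz)) (by linarith) ?_ (Real.exp_pos _).le)
      have := hlog0 ‖f n z‖
      positivity
    have h4 : C < Real.log (1 + ‖f n z₀‖ ^ 2) := by
      rw [Real.lt_log_iff_exp_lt (by positivity)]
      nlinarith [sq_nonneg (‖f n z₀‖ - 1), norm_nonneg (f n z₀)]
    nlinarith [mul_pos hM0 hr]
  · rw [tendsto_atTop] at htend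
    push Not at htend
    obtain ⟨A, hA⟩ := htend
    obtain ⟨φ, hφ, hφA⟩ := extraction_of_frequently_atTop hA
    set C := Real.exp 4 * (M * r + Real.log (1 + A ^ 2)) with hC
    have hbound : ∀ n, ∀ z ∈ Metric.ball z₀ (r / 2), ‖f (φ n) z‖ ≤ Real.exp C := fun n z hz => by
      have h1 := (hcomp (φ n) z hz).1
      have h2 : Real.log (1 + ‖f (φ n) z₀‖ ^ 2) ≤ Real.log (1 + A ^ 2) := by
        apply Real.log_le_log (by positivity)
        have := norm_nonneg (f (φ n) z₀)
        nlinarith [hφA n]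
      have h3 : M * r + Real.log (1 + ‖f (φ n) z‖ ^ 2) ≤ C := by
        refine h1.trans (mul_le_mul (hexp z hz) (by linarith) ?_ (Real.exp_pos _).le)
        have := hlog0 ‖f (φ n) z₀‖
        positivity
      have h4 : Real.log (1 + ‖f (φ n) z‖ ^ 2) ≤ C := by nlinarith [mul_pos hM0 hr]
      rw [Real.log_le_iff_le_exp (by positivity)] at h4
      nlinarith [sq_nonneg (‖f (φ n) z‖ - 1), norm_nonneg (f (φ n) z)]
    obtain ⟨ψ, hψ, g, hg, hlim⟩ := exists_subseq_tendstoLocallyUniformlyOn_of_bounded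
      (U := Metric.ball z₀ (r / 2)) Metric.isOpen_ball (fun n => f (φ n))
      (fun n => (h𝓕 _ (hf _)).differentiableOn)
      (fun K hK _ => ⟨Real.exp C, fun n z hz => hbound n z (hK hz)⟩)
    exact ⟨φ ∘ ψ, hφ.comp hψ, Or.inl ⟨g, hg, hlim⟩⟩

theorem exists_rescaling_point {f : ℂ → ℂ} (hf : Differentiable ℂ f) {w₀ : ℂ} {r N : ℝ}
    (hr : 0 < r) (hN : 0 < N)
    (h : ∃ z ∈ Metric.ball w₀ r, ‖f z‖ ≤ 1 ∧ N / r < ‖deriv f z‖) :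
    ∃ (c : ℂ) (ρ : ℝ), 0 < ρ ∧ ρ ≤ 2 * r / N ∧ dist c w₀ ≤ 2 * r ∧ ‖f c‖ ≤ 1 ∧
      ρ * ‖deriv f c‖ = 1 ∧
      ∀ ζ ∈ Metric.ball (0 : ℂ) (N / 2), ‖f (c + ρ * ζ)‖ ≤ 1 → ρ * ‖deriv f (c + ρ * ζ)‖ ≤ 2 := by
  obtain ⟨z, hz, hfz, hdz⟩ := h
  rw [Metric.mem_ball] at hz
  have hcpt : IsCompact (Metric.closedBall w₀ (2 * r) ∩ {v : ℂ | ‖f v‖ ≤ 1}) :=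
    (isCompact_closedBall _ _).inter_right (isClosed_le hf.continuous.norm continuous_const)
  have hcont : Continuous (fun v => (2 * r - dist v w₀) * ‖deriv f v‖) := by
    have : Continuous (deriv f) := (hf.contDiff (n := 1)).continuous_deriv le_rfl
    fun_prop
  obtain ⟨c, ⟨hc, hfc⟩, hmax⟩ := hcpt.exists_isMaxOn
    ⟨z, Metric.mem_closedBall.2 (by linarith), hfz⟩ hcont.continuousOn
  rw [Metric.mem_closedBall] at hc
  set A := (2 * r - dist c w₀) * ‖deriv f c‖ with hA
  have hNA : N < A := by
    have h1 : (2 * r - dist z w₀) * ‖deriv f z‖ ≤ A :=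
      hmax ⟨Metric.mem_closedBall.2 (by linarith), hfz⟩
    rw [div_lt_iff₀ hr] at hdz
    nlinarith [norm_nonneg (deriv f z)]
  have hA0 : 0 < A := hN.trans hNA
  set s := 2 * r - dist c w₀ with hs
  have hs0 : 0 < s := by
    rcases (show 0 ≤ s by linarith).eq_or_lt with h | h
    · rw [hA, ← h, zero_mul] at hA0; exact absurd hA0 (lt_irrefl _)
    · exact h
  refine ⟨c, s / A, by positivity, ?_, hc, hfc, ?_, fun ζ hζ hfζ => ?_⟩
  · rw [div_le_div_iff₀ hA0 hN]
    have : s ≤ 2 * r := by linarith [dist_nonneg (x := c) (y := w₀)]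
    nlinarith
  · rw [div_mul_eq_mul_div, ← hA, div_self hA0.ne']
  · rw [mem_ball_zero_iff] at hζ
    set v := c + ((s / A : ℝ) : ℂ) * ζ with hv
    have hdist : dist v c ≤ s / 2 := by
      rw [hv, dist_eq_norm, add_sub_cancel_left, norm_mul, Complex.norm_real,
        Real.norm_of_nonneg (by positivity), div_mul_eq_mul_div, div_le_iff₀ hA0]
      nlinarith
    have hvw : s / 2 ≤ 2 * r - dist v w₀ := by linarith [dist_triangle v c w₀]
    have h1 : (2 * r - dist v w₀) * ‖deriv f v‖ ≤ A :=
      hmax ⟨Metric.mem_closedBall.2 (by linarith), hfζ⟩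
    rw [div_mul_eq_mul_div, div_le_iff₀ hA0]
    nlinarith [norm_nonneg (deriv f v)]

theorem exists_bound_of_eventually_bound {f : ℕ → ℂ → ℂ} (hf : ∀ n, Continuous (f n)) {K : Set ℂ}
    (hK : IsCompact K) {C : ℝ} (hC : ∀ᶠ n in atTop, ∀ z ∈ K, ‖f n z‖ ≤ C) :
    ∃ C : ℝ, ∀ n, ∀ z ∈ K, ‖f n z‖ ≤ C := by
  obtain ⟨N, hN⟩ := eventually_atTop.1 hC
  choose B hB using fun n => hK.exists_bound_of_continuousOn (hf n).continuousOn
  refine ⟨|C| + ∑ i ∈ Finset.range N, |B i|, fun n z hz => ?_⟩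
  have hsum : 0 ≤ ∑ i ∈ Finset.range N, |B i| := Finset.sum_nonneg fun _ _ => abs_nonneg _
  rcases le_or_gt N n with h | h
  · linarith [hN n h z hz, le_abs_self C]
  · have := Finset.single_le_sum (f := fun i => |B i|) (fun _ _ => abs_nonneg _)
      (Finset.mem_range.2 h)
    linarith [hB n z hz, le_abs_self (B n), abs_nonneg C]

/-- Zalcman-type rescaling at a point where a family of entire functions is not normal. -/
theorem exists_rescaling_limit {𝓕 : Set (ℂ → ℂ)} (h𝓕 : ∀ f ∈ 𝓕, Differentiable ℂ f) {w₀ : ℂ}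
    (hw₀ : ¬ IsNormalAt 𝓕 Set.univ w₀) :
    ∃ (f : ℕ → ℂ → ℂ) (c : ℕ → ℂ) (ρ : ℕ → ℝ) (g : ℂ → ℂ), (∀ n, f n ∈ 𝓕) ∧ (∀ n, 0 < ρ n) ∧
      Tendsto c atTop (𝓝 w₀) ∧ Tendsto ρ atTop (𝓝 0) ∧ Differentiable ℂ g ∧ deriv g 0 ≠ 0 ∧
      (∀ z, ‖deriv g z‖ ≤ 8 * max 1 ‖g z‖) ∧
      TendstoLocallyUniformlyOn (fun n ζ => f n (c n + ρ n * ζ)) g atTop Set.univ := by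
  have hpt : ∀ n : ℕ, ∃ f ∈ 𝓕, ∃ (c : ℂ) (ρ : ℝ), 0 < ρ ∧ ρ ≤ 1 / ((n : ℝ) + 1) ∧
      dist c w₀ ≤ 2 * (1 / ((n : ℝ) + 1)) ∧ ‖f c‖ ≤ 1 ∧ ρ * ‖deriv f c‖ = 1 ∧
      ∀ ζ ∈ Metric.ball (0 : ℂ) ((n : ℝ) + 1), ‖f (c + ρ * ζ)‖ ≤ 1 →
        ρ * ‖deriv f (c + ρ * ζ)‖ ≤ 2 := fun n => by
    have hn : (0 : ℝ) < n + 1 := by positivity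
    have hr : 0 < 1 / ((n : ℝ) + 1) := by positivity
    have hN : 0 < 2 * ((n : ℝ) + 1) := by positivity
    have : ∃ f ∈ 𝓕, ∃ z ∈ Metric.ball w₀ (1 / ((n : ℝ) + 1)), ‖f z‖ ≤ 1 ∧
        2 * ((n : ℝ) + 1) / (1 / ((n : ℝ) + 1)) < ‖deriv f z‖ := by
      by_contra! hcon
      exact hw₀ (isNormalAt_of_norm_deriv_le_on_unit_sublevel h𝓕 hr (div_pos hN hr) hcon)
    obtain ⟨f, hf, hz⟩ := this
    obtain ⟨c, ρ, h1, h2, h3, h4, h5, h6⟩ := exists_rescaling_point (h𝓕 f hf) hr hN hz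
    refine ⟨f, hf, c, ρ, h1, h2.trans ?_, h3, h4, h5, fun ζ hζ => h6 ζ ?_⟩
    · rw [div_le_iff₀ hN]
      have : (1 : ℝ) ≤ n + 1 := by linarith [Nat.cast_nonneg (α := ℝ) n]
      nlinarith
    · rwa [mul_div_cancel_left₀ _ two_ne_zero]
  choose f hf𝓕 c ρ hρ0 hρ hc hfc hder hbd using hpt
  have hfd : ∀ n, Differentiable ℂ (f n) := fun n => h𝓕 _ (hf𝓕 n)
  set h : ℕ → ℂ → ℂ := fun n ζ => f n (c n + ρ n * ζ) with hh
  have hderiv : ∀ n ζ, HasDerivAt (h n) (deriv (f n) (c n + ρ n * ζ) * ρ n) ζ := fun n ζ => by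
    have h1 : HasDerivAt (fun ζ : ℂ => c n + ρ n * ζ) (ρ n : ℂ) ζ := by
      simpa using ((hasDerivAt_id ζ).const_mul (ρ n : ℂ)).const_add (c n)
    exact (hfd n _).hasDerivAt.comp ζ h1
  have hhd : ∀ n, Differentiable ℂ (h n) := fun n ζ => (hderiv n ζ).differentiableAt
  have hnorm : ∀ n ζ, ‖deriv (h n) ζ‖ = ρ n * ‖deriv (f n) (c n + ρ n * ζ)‖ := fun n ζ => by
    rw [(hderiv n ζ).deriv, norm_mul, Complex.norm_real, Real.norm_of_nonneg (hρ0 n).le, mul_comm]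
  have hh1 : ∀ n : ℕ, ∀ ζ ∈ Metric.ball (0 : ℂ) ((n : ℝ) + 1), ‖h n ζ‖ ≤ 1 → ‖deriv (h n) ζ‖ ≤ 2 :=
    fun n ζ hζ hle => by rw [hnorm]; exact hbd n ζ hζ hle
  have hlarge : ∀ T : ℝ, ∀ᶠ n : ℕ in atTop, T ≤ (n : ℝ) + 1 := fun T =>
    (tendsto_atTop_add_const_right _ _ tendsto_natCast_atTop_atTop).eventually_ge_atTop T
  obtain ⟨φ, hφ, g, hg, hlim⟩ := exists_subseq_tendstoLocallyUniformlyOn_of_bounded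
    isOpen_univ h (fun n => (hhd n).differentiableOn) (fun K _ hK => by
      obtain ⟨T, hT⟩ := hK.isBounded.subset_closedBall (0 : ℂ)
      refine exists_bound_of_eventually_bound (C := Real.exp (3 + 32 * |T|))
        (fun n => (hhd n).continuous) hK ?_
      filter_upwards [hlarge (16 * |T| + 1)] with n hn z hz
      have hn0 : (0 : ℝ) < n + 1 := by positivity
      have hzT : dist z 0 ≤ |T| := (Metric.mem_closedBall.1 (hT hz)).trans (le_abs_self T)
      have h1 := (log_one_add_sq_norm_comparison (hhd n) two_pos (hh1 n)
        (z := z) (Metric.mem_ball.2 (by linarith [abs_nonneg T]))).1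
      set x := 8 / ((n : ℝ) + 1) * dist z 0 with hx
      have hx0 : 0 ≤ x := by positivity
      have hxT : x * (n + 1) ≤ 8 * |T| := by
        rw [hx]; field_simp; linarith
      have hx1 : x ≤ 1 := by nlinarith
      have hexp := (abs_le.1 (Real.abs_exp_sub_one_le (by rwa [abs_of_nonneg hx0]))).2
      rw [abs_of_nonneg hx0] at hexp
      have hl0 : Real.log (1 + ‖h n 0‖ ^ 2) ≤ 1 := by
        have hn1 : ‖h n 0‖ ≤ 1 := by simpa [hh] using hfc n
        have := Real.log_le_sub_one_of_pos (show 0 < 1 + ‖h n 0‖ ^ 2 by positivity)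
        nlinarith [norm_nonneg (h n 0)]
      have hl0' : 0 ≤ Real.log (1 + ‖h n 0‖ ^ 2) :=
        Real.log_nonneg (by nlinarith [norm_nonneg (h n 0)])
      have h2 : Real.exp x * (2 * (n + 1) + Real.log (1 + ‖h n 0‖ ^ 2)) ≤
          (1 + 2 * x) * (2 * (n + 1) + 1) := by gcongr; linarith
      have h4 : Real.log (1 + ‖h n z‖ ^ 2) ≤ 3 + 32 * |T| := by nlinarith
      rw [Real.log_le_iff_le_exp (by positivity)] at h4
      nlinarith [sq_nonneg (‖h n z‖ - 1), norm_nonneg (h n z)])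
  have hone : Tendsto (fun n : ℕ => 1 / ((n : ℝ) + 1)) atTop (𝓝 0) :=
    tendsto_one_div_add_atTop_nhds_zero_nat
  have hc' : Tendsto c atTop (𝓝 w₀) := by
    rw [tendsto_iff_dist_tendsto_zero]
    refine squeeze_zero (fun _ => dist_nonneg) hc ?_
    simpa using hone.const_mul 2
  have hρ' : Tendsto ρ atTop (𝓝 0) := squeeze_zero (fun n => (hρ0 n).le) hρ hone
  have hdlim := hlim.deriv (Eventually.of_forall fun n => (hhd (φ n)).differentiableOn) isOpen_univ
  have hpt1 : ∀ z, Tendsto (fun n => h (φ n) z) atTop (𝓝 (g z)) := fun z =>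
    hlim.tendsto_at (Set.mem_univ z)
  have hpt2 : ∀ z, Tendsto (fun n => deriv (h (φ n)) z) atTop (𝓝 (deriv g z)) := fun z =>
    hdlim.tendsto_at (Set.mem_univ z)
  refine ⟨fun n => f (φ n), fun n => c (φ n), fun n => ρ (φ n), g, fun n => hf𝓕 _, fun n => hρ0 _,
    hc'.comp hφ.tendsto_atTop, hρ'.comp hφ.tendsto_atTop, differentiableOn_univ.1 hg, ?_, ?_, hlim⟩
  · have h1 : Tendsto (fun n => ‖deriv (h (φ n)) 0‖) atTop (𝓝 1) := by
      simp [hnorm, hder]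
    have h2 := tendsto_nhds_unique (hpt2 0).norm h1
    exact norm_pos_iff.1 (by rw [h2]; exact one_pos)
  · intro z
    have hcast : Tendsto (fun n => ((φ n : ℝ) + 1)) atTop atTop :=
      (tendsto_atTop_add_const_right _ _ tendsto_natCast_atTop_atTop).comp hφ.tendsto_atTop
    have h1 : Tendsto (fun n => max 1 ‖h (φ n) z‖ *
        (4 * 2 + 4 * Real.posLog ‖h (φ n) z‖ / ((φ n : ℝ) + 1))) atTop
        (𝓝 (max 1 ‖g z‖ * (4 * 2 + 0))) := by
      refine (tendsto_const_nhds.max (hpt1 z).norm).mul (tendsto_const_nhds.add ?_)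
      refine Tendsto.div_atTop (a := 4 * Real.posLog ‖g z‖) (Tendsto.const_mul _ ?_) hcast
      exact (Real.continuous_posLog.tendsto _).comp (hpt1 z).norm
    have h2 : ‖deriv g z‖ ≤ max 1 ‖g z‖ * (4 * 2 + 0) := by
      refine le_of_tendsto_of_tendsto (hpt2 z).norm h1 ?_
      filter_upwards [hφ.tendsto_atTop.eventually (hlarge (2 * ‖z‖ + 1))] with n hn
      refine norm_deriv_le_of_norm_deriv_le_on_unit_sublevel (hhd _) zero_le_two (hh1 (φ n)) ?_
      rw [mem_ball_zero_iff]
      linarith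
    linarith

theorem frequently_ne_of_deriv_ne_zero {h : ℂ → ℂ} {z : ℂ} (hz : deriv h z ≠ 0) :
    ∃ᶠ w in 𝓝 z, h w ≠ h z :=
  ((differentiableAt_of_deriv_ne_zero hz).hasDerivAt.eventually_ne hz).frequently.filter_mono
    nhdsWithin_le_nhds

/-- If all zeros of `h` are multiple, then `|h'|²` is controlled by `|h|`. -/
theorem sq_norm_deriv_le_of_multiple_zeros {h : ℂ → ℂ} (hh : Differentiable ℂ h) {z : ℂ} {B : ℝ}
    (hB : ∀ w ∈ Metric.ball z 2, ‖h w‖ ≤ B) (hmul : ∀ w, h w = 0 → deriv h w = 0) :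
    ‖deriv h z‖ ^ 2 ≤ 32 * B * ‖h z‖ := by
  by_contra! hcon
  have hder : Differentiable ℂ (deriv h) :=
    differentiableOn_univ.1 (hh.differentiableOn.deriv isOpen_univ)
  have hcauchy : ∀ w ∈ Metric.ball z 1, ‖deriv h w‖ ≤ B := fun w hw => by
    refine (Complex.norm_deriv_le_of_forall_mem_sphere_norm_le one_pos hh.diffContOnCl
      (fun v hv => hB v ?_)).trans_eq (div_one B)
    rw [Metric.mem_ball] at *
    linarith [dist_triangle v w z, Metric.mem_sphere.1 hv]
  have hz1 := Metric.mem_ball_self (x := z) one_pos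
  have hlip : ∀ w ∈ Metric.ball z 1, ‖deriv h w - deriv h z‖ ≤ 2 * B * dist w z := fun w hw => by
    have := Complex.dist_le_div_mul_dist_of_mapsTo_ball (R₂ := 2 * B) hder.differentiableOn
      (fun v hv => ?_) hw
    · rwa [div_one, dist_eq_norm] at this
    · rw [Metric.mem_closedBall, dist_eq_norm]
      linarith [norm_sub_le (deriv h v) (deriv h z), hcauchy v hv, hcauchy z hz1]
  set a := ‖h z‖ with ha
  set b := ‖deriv h z‖ with hb
  have hbB : b ≤ B := hcauchy z hz1
  have hb0 : 0 ≤ b := norm_nonneg _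
  have ha0 : 0 < a := by
    rcases (norm_nonneg (h z)).eq_or_lt with h0 | h0
    · have h1 := hmul z (norm_eq_zero.1 h0.symm)
      rw [hb, ha, ← h0, h1] at hcon
      simp at hcon
    · exact h0
  have hb1 : 0 < b := by
    rcases hb0.eq_or_lt with h0 | h0
    · rw [← h0] at hcon
      nlinarith [mul_nonneg (hb0.trans hbB) ha0.le]
    · exact h0
  have hB0 : 0 < B := hb1.trans_le hbB
  have hba : 32 * a < b := by nlinarith
  set ρ := 4 * a / b with hρ
  have hρ0 : 0 < ρ := by positivity
  have hρ1 : ρ < 1 := by rw [hρ, div_lt_one hb1]; linarith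
  have hbρ : b * ρ = 4 * a := by rw [hρ]; field_simp
  have hBρ : 8 * (B * ρ) < b := by
    rw [hρ, mul_div_assoc', mul_div_assoc', div_lt_iff₀ hb1]; nlinarith
  have hsub : Metric.closedBall z ρ ⊆ Metric.ball z 1 := Metric.closedBall_subset_ball hρ1
  have htaylor : ∀ w ∈ Metric.closedBall z ρ,
      ‖(h w - deriv h z * w) - (h z - deriv h z * z)‖ ≤ 2 * B * ρ * ‖w - z‖ := fun w hw => by
    refine (convex_closedBall z ρ).norm_image_sub_le_of_norm_hasDerivWithin_le
      (f := fun w => h w - deriv h z * w) (f' := fun w => deriv h w - deriv h z)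
      (fun v _ => ?_) (fun v hv => ?_) (Metric.mem_closedBall_self hρ0.le) hw
    · exact ((hh v).hasDerivAt.sub
        (((hasDerivAt_id v).const_mul (deriv h z)).congr_deriv (mul_one _))).hasDerivWithinAt
    · refine (hlip v (hsub hv)).trans ?_
      have := Metric.mem_closedBall.1 hv
      gcongr
  have himg := hh.diffContOnCl.ball_subset_image_closedBall (z₀ := z) (r := ρ) (ε := 3 * a) hρ0
    (fun w hw => by
      have hw' : ‖w - z‖ = ρ := by rw [← dist_eq_norm]; exact hw
      have h1 := htaylor w (Metric.sphere_subset_closedBall hw)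
      rw [hw', show (h w - deriv h z * w) - (h z - deriv h z * z) =
        (h w - h z) - deriv h z * (w - z) by ring] at h1
      have h2 := norm_sub_norm_le (deriv h z * (w - z)) (h w - h z)
      rw [norm_sub_rev (deriv h z * (w - z)) (h w - h z), norm_mul, hw', ← hb, hbρ] at h2
      linarith [mul_lt_mul_of_pos_right hBρ hρ0])
    (frequently_ne_of_deriv_ne_zero (norm_pos_iff.1 hb1))
  obtain ⟨w, hw, hw0⟩ := himg (show (0 : ℂ) ∈ _ by
    rw [Metric.mem_ball, dist_zero_left]; linarith)
  have h1 := hlip w (hsub hw)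
  rw [hmul w hw0, zero_sub, norm_neg, ← hb] at h1
  have := Metric.mem_closedBall.1 hw
  nlinarith

/-- If `|u| ≤ C |v|` for entire functions with `v ≢ 0`, then `u` is a constant multiple of `v`. -/
theorem exists_eq_const_mul_of_norm_le {u v : ℂ → ℂ} (hu : Differentiable ℂ u)
    (hv : Differentiable ℂ v) {C : ℝ} (hC : ∀ z, ‖u z‖ ≤ C * ‖v z‖) (hv0 : ∃ z, v z ≠ 0) :
    ∃ c : ℂ, ∀ z, u z = c * v z := by
  have hne : ∀ z, ∀ᶠ w in 𝓝[≠] z, v w ≠ 0 := fun z => by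
    refine (hv.analyticAt z).eventually_eq_zero_or_eventually_ne_zero.resolve_left fun h => ?_
    obtain ⟨y, hy⟩ := hv0
    have hva : AnalyticOnNhd ℂ v Set.univ := fun x _ => hv.analyticAt x
    exact hy (congrFun (hva.eq_of_eventuallyEq (g := fun _ => 0)
      (fun _ _ => analyticAt_const) h) y)
  set q : ℂ → ℂ := fun z => u z / v z with hq
  have hqd : ∀ z, v z ≠ 0 → DifferentiableAt ℂ q z := fun z hz => (hu z).div (hv z) hz
  have hqC : ∀ z, v z ≠ 0 → ‖q z‖ ≤ C := fun z hz => by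
    rw [hq]; simp only
    rw [norm_div, div_le_iff₀ (norm_pos_iff.2 hz)]; exact hC z
  set Q : ℂ → ℂ := fun z => limUnder (𝓝[≠] z) q with hQ
  have hQq : ∀ z, v z ≠ 0 → Q z = q z := fun z hz =>
    ((hqd z hz).continuousAt.tendsto.mono_left nhdsWithin_le_nhds).limUnder_eq
  have hQd : ∀ z, DifferentiableAt ℂ Q z := fun z => by
    have hs : {w | w ≠ z → v w ≠ 0} ∈ 𝓝 z := eventually_nhdsWithin_iff.1 (hne z)
    have hd := Complex.differentiableOn_update_limUnder_of_bddAbove (f := q) hs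
      (fun w hw => (hqd w (hw.1 hw.2)).differentiableWithinAt)
      ⟨C, by rintro _ ⟨w, hw, rfl⟩; exact hqC w (hw.1 hw.2)⟩
    refine (hd.differentiableAt hs).congr_of_eventuallyEq ?_
    filter_upwards [hs] with w hw
    rcases eq_or_ne w z with rfl | hwz
    · rw [Function.update_self]
    · rw [Function.update_of_ne hwz, hQq w (hw hwz)]
  have hQC : ∀ z, ‖Q z‖ ≤ C := fun z => by
    have hlim : Tendsto (fun w => ‖Q w‖) (𝓝[≠] z) (𝓝 ‖Q z‖) :=
      (hQd z).continuousAt.norm.tendsto.mono_left nhdsWithin_le_nhds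
    refine le_of_tendsto hlim ?_
    filter_upwards [hne z] with w hw
    rw [hQq w hw]
    exact hqC w hw
  have hbdd : Bornology.IsBounded (Set.range Q) :=
    isBounded_iff_forall_norm_le.2 ⟨C, by rintro _ ⟨z, rfl⟩; exact hQC z⟩
  refine ⟨Q 0, fun z => ?_⟩
  by_cases hz : v z = 0
  · have := hC z
    rw [hz, norm_zero, mul_zero] at this
    rw [hz, mul_zero, norm_le_zero_iff.1 this]
  · rw [Differentiable.apply_eq_apply_of_bounded (fun z => hQd z) hbdd 0 z, hQq z hz]
    exact (div_mul_cancel₀ _ hz).symm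

theorem exists_sq_norm_deriv_le_of_ramified {g : ℂ → ℂ} (hg : Differentiable ℂ g)
    (hgr : ∀ z, ‖deriv g z‖ ≤ 8 * max 1 ‖g z‖) {a : ℂ} (ha : ∀ z, g z = a → deriv g z = 0)
    {A : ℝ} : ∃ K : ℝ, 0 ≤ K ∧ ∀ z, ‖g z‖ ≤ A → ‖deriv g z‖ ^ 2 ≤ K * ‖g z - a‖ := by
  set C := Real.exp 4 * (8 * 4 + Real.log (1 + A ^ 2)) with hC
  refine ⟨32 * (Real.exp C + ‖a‖), by positivity, fun z hz => ?_⟩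
  have hderiv : ∀ w, deriv (fun w => g w - a) w = deriv g w := fun w => deriv_sub_const a
  have hlog0 : ∀ x : ℝ, 0 ≤ Real.log (1 + x ^ 2) := fun x =>
    Real.log_nonneg (by nlinarith [sq_nonneg x])
  have := sq_norm_deriv_le_of_multiple_zeros (hg.sub_const a) (z := z) (B := Real.exp C + ‖a‖)
    (fun w hw => ?_) (fun w hw => ?_)
  · rwa [hderiv] at this
  · refine (norm_sub_le _ _).trans (add_le_add ?_ le_rfl)
    have h1 := (log_one_add_sq_norm_comparison hg (M := 8) (r := 4) (z₀ := z) (by norm_num)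
      (fun v _ hv => by simpa [max_eq_left hv] using hgr v) (z := w) (by norm_num; exact hw)).1
    have h2 : Real.exp (8 / 4 * dist w z) ≤ Real.exp 4 :=
      Real.exp_le_exp.2 (by linarith [Metric.mem_ball.1 hw])
    have h3 : Real.log (1 + ‖g z‖ ^ 2) ≤ Real.log (1 + A ^ 2) := by gcongr
    have h4 : 8 * 4 + Real.log (1 + ‖g w‖ ^ 2) ≤ C := by
      refine h1.trans (mul_le_mul h2 (by linarith) ?_ (Real.exp_pos _).le)
      have := hlog0 ‖g z‖
      positivity
    have h5 : Real.log (1 + ‖g w‖ ^ 2) ≤ C := by linarith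
    rw [Real.log_le_iff_le_exp (by positivity)] at h5
    nlinarith [sq_nonneg (‖g w‖ - 1), norm_nonneg (g w)]
  · rw [hderiv]; exact ha w (sub_eq_zero.1 hw)

theorem le_mul_prod_of_separated {b K δ x₁ x₂ x₃ : ℝ} (hδ : 0 < δ) (hK : 0 ≤ K)
    (h₁ : 0 ≤ x₁) (h₂ : 0 ≤ x₂) (h₃ : 0 ≤ x₃)
    (h₁₂ : 2 * δ ≤ x₁ + x₂) (h₁₃ : 2 * δ ≤ x₁ + x₃) (h₂₃ : 2 * δ ≤ x₂ + x₃)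
    (hb₁ : b ≤ K * x₁) (hb₂ : b ≤ K * x₂) (hb₃ : b ≤ K * x₃) :
    b ≤ K / δ ^ 2 * (x₁ * x₂ * x₃) := by
  have key : ∀ {x y z : ℝ}, 0 ≤ x → δ ≤ y → δ ≤ z → b ≤ K * x →
      b ≤ K / δ ^ 2 * (x * y * z) := fun {x y z} hx hy hz hb => by
    have hy0 := hδ.le.trans hy
    calc b ≤ K * x := hb
      _ = K / δ ^ 2 * (x * δ * δ) := by field_simp
      _ ≤ K / δ ^ 2 * (x * y * z) := by gcongr
  rcases le_or_gt δ x₁ with c₁ | c₁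
  · rcases le_or_gt δ x₂ with c₂ | c₂
    · exact (key h₃ c₁ c₂ hb₃).trans_eq (by ring)
    · exact (key h₂ c₁ (show δ ≤ x₃ by linarith) hb₂).trans_eq (by ring)
  · exact key h₁ (by linarith) (by linarith) hb₁

/-- An entire function with `|g'| ≤ 8 max(1, |g|)` and three finite totally ramified values is
constant. -/
theorem deriv_eq_zero_of_three_ramified_values {g : ℂ → ℂ} (hg : Differentiable ℂ g)
    (hgr : ∀ z, ‖deriv g z‖ ≤ 8 * max 1 ‖g z‖) {a₁ a₂ a₃ : ℂ}
    (h₁₂ : a₁ ≠ a₂) (h₁₃ : a₁ ≠ a₃) (h₂₃ : a₂ ≠ a₃)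
    (ha₁ : ∀ z, g z = a₁ → deriv g z = 0) (ha₂ : ∀ z, g z = a₂ → deriv g z = 0)
    (ha₃ : ∀ z, g z = a₃ → deriv g z = 0) (z : ℂ) : deriv g z = 0 := by
  have hder : Differentiable ℂ (deriv g) :=
    differentiableOn_univ.1 (hg.differentiableOn.deriv isOpen_univ)
  set A := 1 + 2 * (‖a₁‖ + ‖a₂‖ + ‖a₃‖) with hA
  obtain ⟨K₁, hK₁, hb₁⟩ := exists_sq_norm_deriv_le_of_ramified hg hgr ha₁ (A := A)
  obtain ⟨K₂, hK₂, hb₂⟩ := exists_sq_norm_deriv_le_of_ramified hg hgr ha₂ (A := A)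
  obtain ⟨K₃, hK₃, hb₃⟩ := exists_sq_norm_deriv_le_of_ramified hg hgr ha₃ (A := A)
  set K := K₁ + K₂ + K₃ with hK
  set δ := min ‖a₁ - a₂‖ (min ‖a₁ - a₃‖ ‖a₂ - a₃‖) / 2 with hδ
  have hδ0 : 0 < δ := half_pos (lt_min (norm_pos_iff.2 (sub_ne_zero.2 h₁₂))
    (lt_min (norm_pos_iff.2 (sub_ne_zero.2 h₁₃)) (norm_pos_iff.2 (sub_ne_zero.2 h₂₃))))
  have hsep : ∀ w a b : ℂ, ‖a - b‖ ≤ ‖w - a‖ + ‖w - b‖ := fun w a b => by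
    rw [norm_sub_rev w a]; exact norm_sub_le_norm_sub_add_norm_sub a w b
  have hδ₁₂ : 2 * δ ≤ ‖a₁ - a₂‖ := by
    rw [hδ]; linarith [min_le_left ‖a₁ - a₂‖ (min ‖a₁ - a₃‖ ‖a₂ - a₃‖)]
  have hδ' : 2 * δ ≤ min ‖a₁ - a₃‖ ‖a₂ - a₃‖ := by
    rw [hδ]; linarith [min_le_right ‖a₁ - a₂‖ (min ‖a₁ - a₃‖ ‖a₂ - a₃‖)]
  have hδ₁₃ := hδ'.trans (min_le_left _ _)
  have hδ₂₃ := hδ'.trans (min_le_right _ _)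
  have hlarge : ∀ z, A < ‖g z‖ →
      ‖g z‖ ^ 3 / 8 ≤ ‖g z - a₁‖ * ‖g z - a₂‖ * ‖g z - a₃‖ ∧ ‖deriv g z‖ ^ 2 ≤ 64 * ‖g z‖ ^ 2 :=
    fun z hz => by
      have n₁ := norm_nonneg a₁
      have n₂ := norm_nonneg a₂
      have n₃ := norm_nonneg a₃
      have l₁ : ‖g z‖ / 2 ≤ ‖g z - a₁‖ := by linarith [norm_sub_norm_le (g z) a₁]
      have l₂ : ‖g z‖ / 2 ≤ ‖g z - a₂‖ := by linarith [norm_sub_norm_le (g z) a₂]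
      have l₃ : ‖g z‖ / 2 ≤ ‖g z - a₃‖ := by linarith [norm_sub_norm_le (g z) a₃]
      constructor
      · calc ‖g z‖ ^ 3 / 8 = ‖g z‖ / 2 * (‖g z‖ / 2) * (‖g z‖ / 2) := by ring
          _ ≤ _ := by gcongr
      · have := hgr z
        rw [max_eq_right (by linarith)] at this
        calc ‖deriv g z‖ ^ 2 ≤ (8 * ‖g z‖) ^ 2 := by gcongr
          _ = _ := by ring
  set v : ℂ → ℂ := fun z => (g z - a₁) * (g z - a₂) * (g z - a₃) with hv
  have hvn : ∀ z, ‖v z‖ = ‖g z - a₁‖ * ‖g z - a₂‖ * ‖g z - a₃‖ := fun z => by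
    simp [hv]
  have hbound : ∀ z, ‖deriv g z ^ 2‖ ≤ (K / δ ^ 2 + 512) * ‖v z‖ := fun z => by
    rw [norm_pow, hvn, add_mul]
    rcases le_or_gt ‖g z‖ A with h | h
    · have x₁ := norm_nonneg (g z - a₁)
      have x₂ := norm_nonneg (g z - a₂)
      have x₃ := norm_nonneg (g z - a₃)
      have hKs : ∀ k x : ℝ, 0 ≤ x → k ≤ K → k * x ≤ K * x := fun k x hx hk => by gcongr
      have := le_mul_prod_of_separated hδ0 (by positivity : 0 ≤ K) x₁ x₂ x₃
        (hδ₁₂.trans (hsep _ _ _)) (hδ₁₃.trans (hsep _ _ _)) (hδ₂₃.trans (hsep _ _ _))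
        ((hb₁ z h).trans (hKs _ _ x₁ (by linarith))) ((hb₂ z h).trans (hKs _ _ x₂ (by linarith)))
        ((hb₃ z h).trans (hKs _ _ x₃ (by linarith)))
      have : 0 ≤ 512 * (‖g z - a₁‖ * ‖g z - a₂‖ * ‖g z - a₃‖) := by positivity
      linarith
    · obtain ⟨l, l'⟩ := hlarge z h
      have h1 : 1 ≤ ‖g z‖ := by
        linarith [norm_nonneg a₁, norm_nonneg a₂, norm_nonneg a₃]
      have h2 : ‖g z‖ ^ 2 ≤ ‖g z‖ ^ 3 := pow_le_pow_right₀ h1 (by norm_num)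
      have : 0 ≤ K / δ ^ 2 * (‖g z - a₁‖ * ‖g z - a₂‖ * ‖g z - a₃‖) := by positivity
      linarith
  by_contra hz
  have hvz : v z ≠ 0 := fun h0 => by
    have := hbound z
    rw [h0, norm_zero, mul_zero, norm_le_zero_iff] at this
    exact hz (pow_eq_zero_iff two_ne_zero |>.1 this)
  obtain ⟨c, hc⟩ := exists_eq_const_mul_of_norm_le (u := fun z => deriv g z ^ 2) (v := v)
    (hder.pow 2) (((hg.sub_const _).mul (hg.sub_const _)).mul (hg.sub_const _)) hbound ⟨z, hvz⟩
  have hc0 : 0 < ‖c‖ := norm_pos_iff.2 fun h0 => by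
    have := hc z
    rw [h0, zero_mul] at this
    exact hz (pow_eq_zero_iff two_ne_zero |>.1 this)
  have hgb : ∀ w, ‖g w‖ ≤ A + 512 / ‖c‖ := fun w => by
    have hc1 : 0 < 512 / ‖c‖ := by positivity
    rcases le_or_gt ‖g w‖ A with h | h
    · linarith
    · obtain ⟨l, l'⟩ := hlarge w h
      have h1 : 0 < ‖g w‖ := by
        linarith [norm_nonneg a₁, norm_nonneg a₂, norm_nonneg a₃]
      have h2 := congrArg norm (hc w)
      simp only [norm_pow, norm_mul] at h2
      rw [hvn] at h2
      have h3 : ‖c‖ * (‖g w‖ ^ 3 / 8) ≤ 64 * ‖g w‖ ^ 2 := by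
        refine le_trans ?_ l'
        rw [h2]
        gcongr
      have h4 : ‖g w‖ ≤ 512 / ‖c‖ := by
        rw [le_div_iff₀ hc0]
        have : 0 < ‖g w‖ ^ 2 := by positivity
        by_contra! hlt
        nlinarith
      linarith [norm_nonneg a₁, norm_nonneg a₂, norm_nonneg a₃]
  have hbdd : Bornology.IsBounded (Set.range g) :=
    isBounded_iff_forall_norm_le.2 ⟨_, by rintro _ ⟨w, rfl⟩; exact hgb w⟩
  have hconst : g = fun _ => g 0 := funext fun w => hg.apply_eq_apply_of_bounded hbdd w 0
  exact hz (by rw [hconst]; simp)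

/-- Hurwitz: a simple zero of a locally uniform limit persists, with a lower bound for the
derivative. -/
theorem exists_zero_near_of_tendstoLocallyUniformlyOn {H : ℕ → ℂ → ℂ} {G : ℂ → ℂ}
    (hd : ∀ n, Differentiable ℂ (H n)) (hG : TendstoLocallyUniformlyOn H G atTop Set.univ) {ζ₀ : ℂ}
    (h0 : G ζ₀ = 0) (h1 : deriv G ζ₀ ≠ 0) :
    ∃ κ > 0, ∀ᶠ n in atTop, ∃ ζ, dist ζ ζ₀ ≤ 1 ∧ H n ζ = 0 ∧ κ ≤ ‖deriv (H n) ζ‖ := by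
  have hGd : Differentiable ℂ G := differentiableOn_univ.1
    (hG.differentiableOn (Eventually.of_forall fun n => (hd n).differentiableOn) isOpen_univ)
  have hG'd : Continuous (deriv G) := (hGd.contDiff (n := 1)).continuous_deriv le_rfl
  have hG' := hG.deriv (Eventually.of_forall fun n => (hd n).differentiableOn) isOpen_univ
  set b := ‖deriv G ζ₀‖ with hb
  have hb0 : 0 < b := norm_pos_iff.2 h1
  have e1 : ∀ᶠ w in 𝓝 ζ₀, b / 2 < ‖deriv G w‖ :=
    hG'd.norm.continuousAt.eventually_const_lt (half_lt_self hb0)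
  have e2 : ∀ᶠ w in 𝓝 ζ₀, w ≠ ζ₀ → G w ≠ 0 := by
    rw [← h0]; exact eventually_nhdsWithin_iff.1 ((hGd ζ₀).hasDerivAt.eventually_ne h1)
  obtain ⟨δ', hδ', hball⟩ := Metric.nhds_basis_closedBall.eventually_iff.1 (e1.and e2)
  set δ := min δ' 1 with hδ
  have hδ0 : 0 < δ := lt_min hδ' one_pos
  have hball : ∀ w ∈ Metric.closedBall ζ₀ δ, b / 2 < ‖deriv G w‖ ∧ (w ≠ ζ₀ → G w ≠ 0) :=
    fun w hw => hball (Metric.closedBall_subset_closedBall (min_le_left _ _) hw)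
  obtain ⟨s, hs, hmin⟩ := (isCompact_sphere ζ₀ δ).exists_isMinOn
    (NormedSpace.sphere_nonempty.2 hδ0.le) hGd.continuous.norm.continuousOn
  have hε0 : 0 < ‖G s‖ := norm_pos_iff.2 ((hball s (Metric.sphere_subset_closedBall hs)).2
    (Metric.ne_of_mem_sphere hs hδ0.ne'))
  set ε := ‖G s‖ with hε
  have hK := isCompact_closedBall ζ₀ δ
  have u1 := (tendstoLocallyUniformlyOn_iff_forall_isCompact isOpen_univ).1 hG _
    (Set.subset_univ _) hK
  have u2 := (tendstoLocallyUniformlyOn_iff_forall_isCompact isOpen_univ).1 hG' _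
    (Set.subset_univ _) hK
  refine ⟨b / 4, by positivity, ?_⟩
  filter_upwards [Metric.tendstoUniformlyOn_iff.1 u1 (ε / 4) (by positivity),
    Metric.tendstoUniformlyOn_iff.1 u2 (b / 4) (by positivity)] with n hn hn'
  have hlow : ∀ w ∈ Metric.closedBall ζ₀ δ, b / 4 ≤ ‖deriv (H n) w‖ := fun w hw => by
    have := hn' w hw
    rw [dist_eq_norm] at this
    simp only [Function.comp_apply] at this
    linarith [norm_sub_norm_le (deriv G w) (deriv (H n) w), (hball w hw).1]
  have hζ₀ := Metric.mem_closedBall_self (x := ζ₀) hδ0.le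
  have hc := hn ζ₀ hζ₀
  rw [h0, dist_zero_left] at hc
  have himg := (hd n).diffContOnCl.ball_subset_image_closedBall (z₀ := ζ₀) (r := δ) (ε := ε / 2)
    hδ0 (fun w hw => by
      have h2 := hn w (Metric.sphere_subset_closedBall hw)
      rw [dist_eq_norm] at h2
      have h3 : ε ≤ ‖G w‖ := hmin hw
      linarith [norm_sub_norm_le (G w) (H n w), norm_sub_norm_le (H n w) (H n ζ₀)])
    (frequently_ne_of_deriv_ne_zero (norm_pos_iff.1 (lt_of_lt_of_le (by positivity) (hlow ζ₀ hζ₀))))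
  obtain ⟨ζ, hζ, hζ0⟩ := himg (show (0 : ℂ) ∈ _ by
    rw [Metric.mem_ball, dist_zero_left]; linarith)
  exact ⟨ζ, (Metric.mem_closedBall.1 hζ).trans (min_le_right _ _), hζ0, hlow ζ hζ⟩

theorem tendstoLocallyUniformlyOn_comp_sub_affine {P : ℂ → ℂ} (hP : Continuous P)
    {h : ℕ → ℂ → ℂ} {g : ℂ → ℂ} (hh : ∀ n, Continuous (h n)) (hg : Continuous g)
    (hlim : TendstoLocallyUniformlyOn h g atTop Set.univ) {c : ℕ → ℂ} {ρ : ℕ → ℝ} {w₀ : ℂ}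
    (hc : Tendsto c atTop (𝓝 w₀)) (hρ : Tendsto ρ atTop (𝓝 0)) :
    TendstoLocallyUniformlyOn (fun n ζ => P (h n ζ) - (c n + ρ n * ζ)) (fun ζ => P (g ζ) - w₀)
      atTop Set.univ := by
  rw [tendstoLocallyUniformlyOn_univ] at hlim ⊢
  have h1 : Tendsto (fun n => (⟨h n, hh n⟩ : C(ℂ, ℂ))) atTop (𝓝 ⟨g, hg⟩) :=
    ContinuousMap.tendsto_iff_tendstoLocallyUniformly.2 hlim
  have h2 := ((ContinuousMap.continuous_postcomp (X := ℂ) ⟨P, hP⟩).tendsto _).comp h1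
  have h3 : Tendsto (fun n => ContinuousMap.const ℂ (c n)) atTop (𝓝 (ContinuousMap.const ℂ w₀)) :=
    (ContinuousMap.continuous_const'.tendsto w₀).comp hc
  have h4 := hρ.smul_const (ContinuousMap.id ℂ)
  have h5 := ContinuousMap.tendsto_iff_tendstoLocallyUniformly.1 (h2.sub (h3.add h4))
  have hl : (⇑((ContinuousMap.comp ⟨P, hP⟩ ⟨g, hg⟩ : C(ℂ, ℂ)) -
      (ContinuousMap.const ℂ w₀ + (0 : ℝ) • ContinuousMap.id ℂ))) = fun ζ => P (g ζ) - w₀ := by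
    ext ζ
    simp
  rw [hl] at h5
  exact h5

/-- For a family `𝓕` of non-constant polynomials such that for
each `w₀ ∈ J(𝓕)` some `P₀ ∈ 𝓕` has `P₀ - w₀` with at least three distinct
simple roots, `J(𝓕)` is contained in the closure of the repelling fixed points
of the compositions `P ∘ Q` with `P, Q ∈ 𝓕`. -/
theorem juliaLike_subset_closure_repelling (𝓕 : Set (ℂ → ℂ))
    (hpoly : ∀ f ∈ 𝓕, ∃ p : Polynomial ℂ, 0 < p.natDegree ∧
      f = fun z => p.eval z)
    (hroots : ∀ w₀ ∈ juliaLike 𝓕 Set.univ, ∃ P₀ ∈ 𝓕, ∃ z₁ z₂ z₃ : ℂ,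
      z₁ ≠ z₂ ∧ z₁ ≠ z₃ ∧ z₂ ≠ z₃ ∧
      P₀ z₁ = w₀ ∧ P₀ z₂ = w₀ ∧ P₀ z₃ = w₀ ∧
      deriv P₀ z₁ ≠ 0 ∧ deriv P₀ z₂ ≠ 0 ∧ deriv P₀ z₃ ≠ 0) :
    juliaLike 𝓕 Set.univ ⊆
      closure {w : ℂ | ∃ P ∈ 𝓕, ∃ Q ∈ 𝓕,
        (P ∘ Q) w = w ∧ 1 < ‖deriv (P ∘ Q) w‖} := by
  intro w₀ hw₀
  have h𝓕 : ∀ f ∈ 𝓕, Differentiable ℂ f := fun f hf => by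
    obtain ⟨p, -, rfl⟩ := hpoly f hf
    exact p.differentiable
  have hnn : ¬ IsNormalAt 𝓕 Set.univ w₀ := fun h => hw₀.2 ⟨Set.mem_univ _, h⟩
  obtain ⟨P, hP𝓕, z₁, z₂, z₃, h₁₂, h₁₃, h₂₃, hz₁, hz₂, hz₃, hd₁, hd₂, hd₃⟩ := hroots w₀ hw₀
  obtain ⟨f, c, ρ, g, hf, hρ, hcw, hρ0, hg, hg0, hgr, hlim⟩ := exists_rescaling_limit h𝓕 hnn
  have hP := h𝓕 P hP𝓕
  obtain ⟨ζ₀, hζP, hζP', hζg⟩ :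
      ∃ ζ₀, P (g ζ₀) = w₀ ∧ deriv P (g ζ₀) ≠ 0 ∧ deriv g ζ₀ ≠ 0 := by
    by_contra! hcon
    refine hg0 (deriv_eq_zero_of_three_ramified_values hg hgr h₁₂ h₁₃ h₂₃ ?_ ?_ ?_ 0)
    · rintro ζ rfl
      exact hcon ζ hz₁ hd₁
    · rintro ζ rfl
      exact hcon ζ hz₂ hd₂
    · rintro ζ rfl
      exact hcon ζ hz₃ hd₃
  have haff : ∀ n ζ, HasDerivAt (fun ζ : ℂ => c n + ρ n * ζ) (ρ n : ℂ) ζ := fun n ζ =>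
    (((hasDerivAt_id ζ).const_mul (ρ n : ℂ)).congr_deriv (mul_one _)).const_add (c n)
  have hcomp : ∀ n ζ, HasDerivAt (fun ζ : ℂ => P (f n (c n + ρ n * ζ)) - (c n + ρ n * ζ))
      (deriv (P ∘ f n) (c n + ρ n * ζ) * ρ n - ρ n) ζ := fun n ζ =>
    HasDerivAt.sub (f := (P ∘ f n) ∘ fun ζ : ℂ => c n + ρ n * ζ)
      (((hP.comp (h𝓕 _ (hf n))) (c n + ρ n * ζ)).hasDerivAt.comp ζ (haff n ζ)) (haff n ζ)
  have hlim' := tendstoLocallyUniformlyOn_comp_sub_affine hP.continuous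
    (fun n => ((h𝓕 _ (hf n)).comp fun ζ => (haff n ζ).differentiableAt).continuous)
    hg.continuous hlim hcw hρ0
  have hG' : deriv (fun ζ => P (g ζ) - w₀) ζ₀ ≠ 0 := by
    rw [deriv_sub_const, show (fun ζ => P (g ζ)) = P ∘ g from rfl, deriv_comp ζ₀ (hP _) (hg _)]
    exact mul_ne_zero hζP' hζg
  obtain ⟨κ, hκ, hev⟩ := exists_zero_near_of_tendstoLocallyUniformlyOn
    (fun n ζ => (hcomp n ζ).differentiableAt) hlim' (sub_eq_zero.2 hζP) hG'
  rw [Metric.mem_closure_iff]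
  intro ε hε
  have e1 : ∀ᶠ n in atTop, dist (c n) w₀ < ε / 2 := Metric.tendsto_nhds.1 hcw _ (half_pos hε)
  have e2 : ∀ᶠ n in atTop, ρ n * (‖ζ₀‖ + 1) < ε / 2 := by
    have := hρ0.mul_const (‖ζ₀‖ + 1)
    rw [zero_mul] at this
    exact this.eventually_lt_const (half_pos hε)
  have e3 : ∀ᶠ n in atTop, ρ n < κ / 2 := hρ0.eventually_lt_const (half_pos hκ)
  obtain ⟨n, ⟨ζ, hζ, hzero, hder⟩, h1, h2, h3⟩ := (hev.and (e1.and (e2.and e3))).exists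
  refine ⟨c n + ρ n * ζ, ⟨P, hP𝓕, f n, hf n, sub_eq_zero.1 hzero, ?_⟩, ?_⟩
  · rw [(hcomp n ζ).deriv] at hder
    have := norm_sub_le (deriv (P ∘ f n) (c n + ρ n * ζ) * ρ n) (ρ n)
    rw [norm_mul, Complex.norm_of_nonneg (hρ n).le] at this
    by_contra! hle
    have := mul_le_mul_of_nonneg_right hle (hρ n).le
    linarith
  · have hζn : ‖ζ‖ ≤ ‖ζ₀‖ + 1 := by
      linarith [norm_le_norm_add_norm_sub' ζ ζ₀, dist_eq_norm ζ ζ₀]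
    have h4 : dist (c n + ρ n * ζ) (c n) ≤ ρ n * (‖ζ₀‖ + 1) := by
      rw [dist_eq_norm, add_sub_cancel_left, norm_mul, Complex.norm_of_nonneg (hρ n).le]
      exact mul_le_mul_of_nonneg_left hζn (hρ n).le
    rw [dist_comm]
    linarith [dist_triangle (c n + ρ n * ζ) (c n) w₀]
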